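/- Let X be a set, F a birestriction monoid, and ι : X → F a map, with D defined on words over X ∪ X⁻¹ as in the context. Then for all words s, t, u, v over X ∪ X⁻¹: D(s u u⁻¹ v v⁻¹ t) = D(s v v⁻¹ u u⁻¹ t). -/

import Mathlib

/-- A birestriction semigroup: a semigroup with unary operations `bstar` (`^*`) and
`bplus` (`^+`) satisfying the defining identities. -/
class BirSgp (S : Type*) extends Semigroup S where
  bstar : S → S
  bplus : S → S
  mul_bstar : ∀ x : S, x * bstar x = x
  bstar_comm : ∀ x y : S, bstar x * bstar y = bstar y * bstar x
  bstar_mul_bstar : ∀ x y : S, bstar (x * bstar y) = bstar x * bstar y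
  bstar_mul : ∀ x y : S, bstar x * y = y * bstar (x * y)
  bplus_mul : ∀ x : S, bplus x * x = x
  bplus_comm : ∀ x y : S, bplus x * bplus y = bplus y * bplus x
  bplus_mul_bplus : ∀ x y : S, bplus (bplus x * y) = bplus x * bplus y
  mul_bplus : ∀ x y : S, x * bplus y = bplus (x * y) * x
  bstar_bplus : ∀ x : S, bstar (bplus x) = bplus x
  bplus_bstar : ∀ x : S, bplus (bstar x) = bstar x

/-- A birestriction monoid: a birestriction semigroup with an identity element. -/
class BirMon (S : Type*) extends Monoid S, BirSgp S

open BirSgp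

/-- The set of projections `P(S) = {s^* : s ∈ S}`. -/
def proj (S : Type*) [BirSgp S] : Set S := Set.range (bstar : S → S)

/-- The natural partial order: `s ≤ t` iff `s = e * t` for some projection `e`. -/
def nle {S : Type*} [BirSgp S] (s t : S) : Prop := ∃ e ∈ proj S, s = e * t

/-- The relation σ: `s σ t` iff `e * s = e * t` for some projection `e`. -/
def sig {S : Type*} [BirSgp S] (s t : S) : Prop := ∃ e ∈ proj S, e * s = e * t

/-- A birestriction semigroup is proper. -/
def IsProper (S : Type*) [BirSgp S] : Prop :=
  (∀ s t : S, bstar s = bstar t → sig s t → s = t) ∧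
  (∀ s t : S, bplus s = bplus t → sig s t → s = t)

/-- The formal inverse of a word over `X ∪ X⁻¹`: reverse the word and flip all signs. -/
def winv {X : Type*} (w : List (X × Bool)) : List (X × Bool) :=
  (w.map (fun p => (p.1, !p.2))).reverse

/-- The map `D` from words over `X ∪ X⁻¹` to a birestriction monoid `F`:
`D(1) = 1`, `D(w·x) = (D(w) ι(x))^*`, `D(w·x⁻¹) = (ι(x) D(w))^+`. -/
def Dmap {X F : Type*} [BirMon F] (ι : X → F) (w : List (X × Bool)) : F :=
  w.foldl (fun d p => if p.2 then bstar (d * ι p.1) else bplus (ι p.1 * d)) 1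


/-- The one-letter action. -/
def stepD {X F : Type*} [BirMon F] (ι : X → F) (d : F) (p : X × Bool) : F :=
  if p.2 then bstar (d * ι p.1) else bplus (ι p.1 * d)

theorem bstar_one_aux {F : Type*} [BirMon F] : bstar (1 : F) = 1 := by
  have h := mul_bstar (1 : F)
  rwa [one_mul] at h

theorem bstar_idem_aux {F : Type*} [BirMon F] (x : F) : bstar (bstar x) = bstar x := by
  rw [← bplus_bstar x, bstar_bplus]

theorem bplus_of_aux {F : Type*} [BirMon F] {x : F} (h : bstar x = x) : bplus x = x := by
  rw [← h, bplus_bstar]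

theorem stepD_proj {X F : Type*} [BirMon F] (ι : X → F) (d : F) (p : X × Bool) :
    bstar (stepD ι d p) = stepD ι d p := by
  unfold stepD
  split
  · exact bstar_idem_aux _
  · exact bstar_bplus _

theorem foldD_proj {X F : Type*} [BirMon F] (ι : X → F) (w : List (X × Bool)) :
    ∀ d : F, bstar d = d → bstar (w.foldl (stepD ι) d) = w.foldl (stepD ι) d := by
  induction w with
  | nil => intro d h; exact h
  | cons a w ih => intro d _; exact ih _ (stepD_proj ι d a)

theorem stepD_key {X F : Type*} [BirMon F] (ι : X → F) (e g : F) (p : X × Bool)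
    (he : bstar e = e) (hg : bstar g = g) :
    stepD ι (stepD ι e p * g) (p.1, !p.2) = e * stepD ι g (p.1, !p.2) := by
  obtain ⟨x, b⟩ := p
  have he' := bplus_of_aux he
  have hg' := bplus_of_aux hg
  cases b
  · simp only [stepD, Bool.not_false, if_true, Bool.false_eq_true, if_false]
    have h1 : bplus (ι x * e) * g = g * bplus (ι x * e) := by
      have := bplus_comm (ι x * e) g
      rwa [hg'] at this
    have h2 : bplus (ι x * e) * ι x = ι x * e := by
      rw [← mul_bplus, he']
    rw [h1, mul_assoc, h2, ← mul_assoc]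
    have h3 := bstar_mul_bstar (g * ι x) e
    have h4 := bstar_comm (g * ι x) e
    rw [he] at h3 h4
    rw [h3, h4]
  · simp only [stepD, Bool.not_true, if_true, Bool.false_eq_true, if_false]
    have h2 : ι x * bstar (e * ι x) = e * ι x := by
      rw [← bstar_mul, he]
    rw [← mul_assoc, h2, mul_assoc]
    have h3 := bplus_mul_bplus e (ι x * g)
    rw [he'] at h3
    exact h3

theorem foldD_key {X F : Type*} [BirMon F] (ι : X → F) (u : List (X × Bool)) :
    ∀ e g : F, bstar e = e → bstar g = g →
      (winv u).foldl (stepD ι) (u.foldl (stepD ι) e * g) =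
        e * (winv u).foldl (stepD ι) g := by
  induction u with
  | nil => intro e g _ _; rfl
  | cons a u ih =>
    intro e g he hg
    have hw : winv (a :: u) = winv u ++ [(a.1, !a.2)] := by simp [winv]
    simp only [hw, List.foldl_append, List.foldl_cons, List.foldl_nil]
    rw [ih _ g (stepD_proj ι e a) hg]
    exact stepD_key ι e _ a he (foldD_proj ι _ g hg)

theorem foldD_key' {X F : Type*} [BirMon F] (ι : X → F) (u : List (X × Bool)) (e : F)
    (he : bstar e = e) :
    (winv u).foldl (stepD ι) (u.foldl (stepD ι) e) =
        e * (winv u).foldl (stepD ι) 1 := by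
  have h := foldD_key ι u e 1 he bstar_one_aux
  rwa [mul_one] at h

/-- `D(s u u⁻¹ v v⁻¹ t) = D(s v v⁻¹ u u⁻¹ t)`. -/
theorem statement8 {X F : Type*} [BirMon F] (ι : X → F)
    (s t u v : List (X × Bool)) :
    Dmap ι (s ++ u ++ winv u ++ v ++ winv v ++ t) =
      Dmap ι (s ++ v ++ winv v ++ u ++ winv u ++ t) := by
  have hD : ∀ w : List (X × Bool), Dmap ι w = w.foldl (stepD ι) 1 := fun _ => rfl
  rw [hD, hD]
  simp only [List.foldl_append]
  have hs := foldD_proj ι s 1 bstar_one_aux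
  generalize s.foldl (stepD ι) 1 = e at hs
  have hu := foldD_proj ι (winv u) 1 bstar_one_aux
  have hv := foldD_proj ι (winv v) 1 bstar_one_aux
  have p : ∀ w : List (X × Bool), bstar ((winv w).foldl (stepD ι) (w.foldl (stepD ι) e)) =
      (winv w).foldl (stepD ι) (w.foldl (stepD ι) e) := fun w =>
    foldD_proj ι _ _ (foldD_proj ι _ _ hs)
  rw [foldD_key' ι v _ (p u), foldD_key' ι u _ (p v), foldD_key' ι u e hs, foldD_key' ι v e hs,
    mul_assoc, mul_assoc]
  have hc := bstar_comm ((winv u).foldl (stepD ι) 1) ((winv v).foldl (stepD ι) 1)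
  rw [hu, hv] at hc
  rw [hc]
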